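/- Let K be a field and let f : A → B be a degreewise injective quasi-isomorphism of ℤ-indexed cochain complexes of K-vector spaces. Then f admits a retraction which is a chain map: there exists a morphism of complexes g : B → A with g ∘ f = id_A. -/

import Mathlib

open CategoryTheory

/-- Every linear map between vector spaces has a generalized inverse. -/
theorem LinearMap.exists_comp_comp_eq_self {K V W : Type*} [Field K] [AddCommGroup V] [Module K V]
    [AddCommGroup W] [Module K W] (d : V →ₗ[K] W) :
    ∃ t : W →ₗ[K] V, ∀ x, d (t (d x)) = d x := by
  obtain ⟨s, hs⟩ := d.rangeRestrict.exists_rightInverse_of_surjective d.range_rangeRestrict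
  obtain ⟨t, ht⟩ := LinearMap.exists_extend s
  refine ⟨t, fun x ↦ ?_⟩
  have h₁ : t (d x) = s (d.rangeRestrict x) := LinearMap.congr_fun ht (d.rangeRestrict x)
  have h₂ := congrArg Subtype.val (LinearMap.congr_fun hs (d.rangeRestrict x))
  rw [h₁]
  exact h₂

/-- An acyclic complex of vector spaces is contractible. -/
theorem CochainComplex.nonempty_homotopy_id_zero_of_acyclic {K : Type*} [Field K]
    {Q : CochainComplex (ModuleCat K) ℤ} (hQ : Q.Acyclic) :
    Nonempty (Homotopy (𝟙 Q) 0) := by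
  have ht (i j : ℤ) : ∃ t : Q.X i ⟶ Q.X j, Q.d j i ≫ t ≫ Q.d j i = Q.d j i := by
    obtain ⟨t, ht⟩ := (Q.d j i).hom.exists_comp_comp_eq_self
    exact ⟨ModuleCat.ofHom t, by ext x; exact ht x⟩
  choose t ht using ht
  have hcycle (i j k : ℤ) (hij : i + 1 = j) (hjk : j + 1 = k) (x : Q.X j)
      (hx : Q.d j k x = 0) : Q.d i j (t j i x) = x := by
    have hex := hQ j
    rw [Q.exactAt_iff' i j k (by simp; lia) (by simp; lia),
      ShortComplex.moduleCat_exact_iff] at hex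
    obtain ⟨y, rfl⟩ := hex x hx
    exact ConcreteCategory.congr_hom (ht j i) y
  let s (i j : ℤ) (_ : (ComplexShape.up ℤ).Rel j i) : Q.X i ⟶ Q.X j :=
    (𝟙 _ - Q.d i (i + 1) ≫ t (i + 1) i) ≫ t i j
  refine ⟨(Homotopy.ofEq ?_).trans (Homotopy.nullHomotopy' s)⟩
  ext j x
  have hr₁ : (ComplexShape.up ℤ).Rel (j - 1) j := by simp
  have hr₂ : (ComplexShape.up ℤ).Rel j (j + 1) := by simp
  rw [Homotopy.nullHomotopicMap'_f hr₁ hr₂]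
  have hdtd : Q.d j (j + 1) (t (j + 1) j (Q.d j (j + 1) x)) = Q.d j (j + 1) x :=
    ConcreteCategory.congr_hom (ht (j + 1) j) x
  have h := hcycle (j - 1) j (j + 1) (by lia) rfl (x - t (j + 1) j (Q.d j (j + 1) x))
    (by rw [map_sub, hdtd, sub_self])
  simp only [map_sub] at h
  simp [s, h]

/-- Every complex of vector spaces is K-injective. -/
theorem CochainComplex.isKInjective_of_field {K : Type*} [Field K]
    (A : CochainComplex (ModuleCat K) ℤ) : A.IsKInjective where
  nonempty_homotopy_zero {Q} h hQ := by
    obtain ⟨H⟩ := CochainComplex.nonempty_homotopy_id_zero_of_acyclic hQ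
    exact ⟨(Homotopy.ofEq (by simp)).trans ((H.compRight h).trans (Homotopy.ofEq (by simp)))⟩

/-- Let `K` be a field and `f : A → B` a degreewise injective
quasi-isomorphism of `ℤ`-indexed cochain complexes of `K`-vector spaces.  Then `f` admits a
retraction which is a chain map: there is a morphism of complexes `g : B → A` with
`g ∘ f = id_A`. -/
theorem operadic_torsors_stmt14 {K : Type*} [Field K]
    {A B : CochainComplex (ModuleCat K) ℤ} (f : A ⟶ B)
    (hinj : ∀ i : ℤ, Function.Injective (f.f i)) [QuasiIso f] :
    ∃ g : B ⟶ A, f ≫ g = 𝟙 A := by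
  have hr (n : ℤ) : ∃ r : B.X n ⟶ A.X n, f.f n ≫ r = 𝟙 _ := by
    obtain ⟨r, hr⟩ := (f.f n).hom.exists_leftInverse_of_injective (LinearMap.ker_eq_bot.2 (hinj n))
    exact ⟨ModuleCat.ofHom r, by ext x; exact LinearMap.congr_fun hr x⟩
  choose r hr using hr
  have (n : ℤ) : Mono (f.f n) := (ModuleCat.mono_iff_injective _).2 (hinj n)
  have : Mono f := HomologicalComplex.mono_of_mono_f f this
  have : A.IsKInjective := A.isKInjective_of_field
  let Z : CochainComplex (ModuleCat K) ℤ := open ZeroObject in 0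
  have sq : CommSq (𝟙 A) f (0 : A ⟶ Z) (0 : B ⟶ Z) := ⟨by simp⟩
  have hK : Limits.IsLimit (Limits.KernelFork.ofι (𝟙 A) (Limits.comp_zero : 𝟙 A ≫ (0 : A ⟶ Z) = 0)) :=
    Limits.KernelFork.IsLimit.ofId _ rfl
  have hex : (ShortComplex.mk _ _ (Limits.cokernel.condition f)).ShortExact :=
    { exact := ShortComplex.exact_cokernel f }
  obtain ⟨α, hα⟩ := CochainComplex.IsKInjective.eq_δ_of_cocycle
    (CochainComplex.Lifting.cocycle₁ sq
      (fun n ↦ { l := r n, fac_left := hr n, fac_right := Limits.comp_zero })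
      (Limits.cokernelIsCokernel f) hK (hπ := by simp))
    (hex.acyclic_X₃ (by dsimp; infer_instance)) 0 (by simp)
  have := CochainComplex.Lifting.hasLift sq _ (Limits.cokernelIsCokernel f) hK α hα
  exact ⟨sq.lift, sq.fac_left⟩
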